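/- arXiv:1303.4091 — 4 statements merged into one kernel-verified Lean document; each statement's English description precedes it below -/
import Mathlib

section
/- Let p ∈ [1, ∞). Let G be a finitely generated group and N ⊲ G an infinite normal subgroup that is finitely generated as a group and whose growth is at least polynomial of degree d for some d > 2p (there is c > 0 with |B_n^N| ≥ c·n^d for the balls of some Cayley graph Γ_N of N). Assume further that the quotient G/N is infinite and that the reduced ℓ^p-cohomology in degree one of Γ_N is trivial. Then for every Cayley graph Γ_G of G (with respect to a finite symmetric generating set), the reduced ℓ^p-cohomology in degree one of Γ_G is trivial: D^p(Γ_G) equals the D^p-closure of ℓ^p(G) + ℝ·1. -/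
open scoped BigOperators ENNReal NNReal
open Filter Topology

/-- `f` is `p`-summable (`f ∈ ℓ^p`), for a real exponent `0 < p < ∞`. -/
def lpMem {ι : Type*} (p : ℝ) (f : ι → ℝ) : Prop := Summable fun i => |f i| ^ p

/-- The `ℓ^q`-norm with exponent `q ∈ [1,∞]`, valued in `ℝ≥0∞`. -/
noncomputable def lpENorm {ι : Type*} (q : ℝ≥0∞) (f : ι → ℝ) : ℝ≥0∞ :=
  if q = ⊤ then ⨆ i, (‖f i‖₊ : ℝ≥0∞)
  else (∑' i, (‖f i‖₊ : ℝ≥0∞) ^ q.toReal) ^ (1 / q.toReal)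

/-- A bounded real-valued function. -/
def BoundedFun {ι : Type*} (f : ι → ℝ) : Prop := ∃ M : ℝ, ∀ i, |f i| ≤ M

/-- A graph of bounded (locally finite) valency: each vertex has a finite
set of neighbours, the adjacency is symmetric and there are no loops. -/
structure LFGraph (X : Type*) where
  nbr : X → Finset X
  symm : ∀ x y : X, y ∈ nbr x ↔ x ∈ nbr y
  loopless : ∀ x : X, x ∉ nbr x

namespace LFGraph

variable {X : Type*}

/-- Adjacency. -/
def Adj (G : LFGraph X) (x y : X) : Prop := y ∈ G.nbr x

/-- Connectivity of the graph. -/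
def Conn (G : LFGraph X) : Prop := ∀ x y : X, Relation.ReflTransGen G.Adj x y

/-- The valency is bounded by `D`. -/
def BddVal (G : LFGraph X) (D : ℕ) : Prop := ∀ x : X, (G.nbr x).card ≤ D

/-- The set of oriented edges. -/
abbrev Edge (G : LFGraph X) : Type _ := {e : X × X // e.2 ∈ G.nbr e.1}

/-- The gradient `∇g(x,y) = g(y) - g(x)` of a function on the vertices,
as a function on oriented edges. -/
def grad (G : LFGraph X) (g : X → ℝ) (e : G.Edge) : ℝ := g e.1.2 - g e.1.1

/-- `g ∈ D^p(Γ)`: the gradient of `g` is in `ℓ^p(E)` (`p` finite). -/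
def MemDp (G : LFGraph X) (p : ℝ) (g : X → ℝ) : Prop := lpMem p (G.grad g)

/-- The `ℓ^p(E)`-norm of the gradient of `g`. -/
noncomputable def gradNorm (G : LFGraph X) (p : ℝ) (g : X → ℝ) : ℝ :=
  (∑' e : G.Edge, |G.grad g e| ^ p) ^ (1 / p)

/-- The `D^p`-distance between `g` and `h`, with basepoint `e0`:
`‖∇(g-h)‖_{ℓ^p(E)} + |g(e0) - h(e0)|`. -/
noncomputable def dpDist (G : LFGraph X) (p : ℝ) (e0 : X) (g h : X → ℝ) : ℝ :=
  G.gradNorm p (fun x => g x - h x) + |g e0 - h e0|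

/-- `g` belongs to the `D^p`-closure of `ℓ^p(X) + ℝ·1`, i.e. the class of `g`
in the degree one reduced `ℓ^p`-cohomology is trivial. -/
def InClos (G : LFGraph X) (p : ℝ) (e0 : X) (g : X → ℝ) : Prop :=
  ∀ ε : ℝ, 0 < ε → ∃ (f : X → ℝ) (c : ℝ), lpMem p f ∧
    G.MemDp p (fun x => g x - (f x + c)) ∧
    G.dpDist p e0 g (fun x => f x + c) < ε

/-- `g` belongs to the `D^p`-closure of `ℓ^p(X)` (no constants). -/
def InClosLp (G : LFGraph X) (p : ℝ) (e0 : X) (g : X → ℝ) : Prop :=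
  ∀ ε : ℝ, 0 < ε → ∃ f : X → ℝ, lpMem p f ∧
    G.MemDp p (fun x => g x - f x) ∧
    G.dpDist p e0 g f < ε

open Classical in
/-- The number of (oriented) boundary edges of a finite set `A` of vertices. -/
noncomputable def bdry (G : LFGraph X) (A : Finset X) : ℕ :=
  ∑ x ∈ A, ((G.nbr x).filter fun y => y ∉ A).card

/-- The `d`-dimensional isoperimetric profile `IS_d`. -/
def ISdim (G : LFGraph X) (d : ℝ) : Prop :=
  ∃ κ : ℝ, 0 < κ ∧ ∀ A : Finset X, A.Nonempty →
    (A.card : ℝ) ^ (1 - 1 / d) ≤ κ * (G.bdry A : ℝ)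

/-- The strong isoperimetric profile `IS_ω`. -/
def ISomega (G : LFGraph X) : Prop :=
  ∃ κ : ℝ, 0 < κ ∧ ∀ A : Finset X, A.Nonempty →
    (A.card : ℝ) ≤ κ * (G.bdry A : ℝ)

/-- `h` is harmonic: at every vertex, the average of `h` over the
neighbours equals the value of `h`. -/
def Harmonic (G : LFGraph X) (h : X → ℝ) : Prop :=
  ∀ x : X, ∑ y ∈ G.nbr x, h y = ((G.nbr x).card : ℝ) * h x

/-- The graph is Liouville: every bounded harmonic function is constant. -/
def Liouville (G : LFGraph X) : Prop :=
  ∀ h : X → ℝ, G.Harmonic h → BoundedFun h → ∀ x y : X, h x = h y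

open Classical in
/-- `walk G n x y` is the probability `P^{(n)}_x(y)` that the simple random
walk started at `x` is at `y` at time `n`. -/
noncomputable def walk (G : LFGraph X) : ℕ → X → X → ℝ
  | 0, x, y => if y = x then 1 else 0
  | n + 1, x, y => (∑ z ∈ G.nbr x, walk G n z y) / ((G.nbr x).card : ℝ)

/-- `avg G n g x = ∑_y P^{(n)}_x(y) g(y)`, the expected value of `g` after `n`
steps of the simple random walk started at `x`. -/
noncomputable def avg (G : LFGraph X) (n : ℕ) (g : X → ℝ) (x : X) : ℝ :=
  ∑' y, G.walk n x y * g y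

/-- The Markov operator of the simple random walk: average over the neighbours. -/
noncomputable def pAvg (G : LFGraph X) (f : X → ℝ) (x : X) : ℝ :=
  (∑ y ∈ G.nbr x, f y) / ((G.nbr x).card : ℝ)

/-- Reachability in exactly `n` steps. -/
def reachN (G : LFGraph X) : ℕ → X → X → Prop
  | 0, x, y => y = x
  | n + 1, x, y => ∃ z ∈ G.nbr x, reachN G n z y

/-- The graph distance (the smallest `n` such that `y` is reachable from `x`
in `n` steps). -/
noncomputable def gdist (G : LFGraph X) (x y : X) : ℕ :=
  sInf {n : ℕ | G.reachN n x y}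

/-- `f` is a quasi-isometry between the connected graphs `G` and `H`. -/
def QI {X Y : Type*} (G : LFGraph X) (H : LFGraph Y) (f : X → Y) : Prop :=
  G.Conn ∧ H.Conn ∧ ∃ Λ C : ℝ, 1 ≤ Λ ∧ 0 ≤ C ∧
    (∀ x x' : X, (H.gdist (f x) (f x') : ℝ) ≤ Λ * (G.gdist x x') + C) ∧
    (∀ x x' : X, (G.gdist x x' : ℝ) ≤ Λ * (H.gdist (f x) (f x')) + C) ∧
    ∀ y : Y, ∃ x : X, (H.gdist (f x) y : ℝ) ≤ C

/-- Reachability avoiding the finite set `F`. -/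
def reachAvoid (G : LFGraph X) (F : Finset X) : X → X → Prop :=
  Relation.ReflTransGen fun a b => b ∈ G.nbr a ∧ a ∉ F ∧ b ∉ F

/-- The graph has at most one end: for every finite set `F` of vertices,
the complement of `F` has at most one infinite connected component. -/
def AtMostOneEnd (G : LFGraph X) : Prop :=
  ∀ F : Finset X, ∀ x y : X, x ∉ F → y ∉ F →
    {z | G.reachAvoid F x z}.Infinite → {z | G.reachAvoid F y z}.Infinite →
    G.reachAvoid F x y

end LFGraph

/-- The Cayley graph of a group with respect to a finite symmetric generating
set `S` not containing the identity: the neighbours of `x` are the `s * x`, `s ∈ S`. -/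
def cayley {Γ : Type*} [Group Γ] [DecidableEq Γ] (S : Finset Γ)
    (hsym : ∀ s ∈ S, s⁻¹ ∈ S) (h1 : (1 : Γ) ∉ S) : LFGraph Γ where
  nbr x := S.image fun s => s * x
  symm := by
    intro x y
    simp only [Finset.mem_image]
    constructor
    · rintro ⟨s, hs, rfl⟩
      exact ⟨s⁻¹, hsym s hs, by group⟩
    · rintro ⟨s, hs, rfl⟩
      exact ⟨s⁻¹, hsym s hs, by group⟩
  loopless := by
    intro x hx
    rw [Finset.mem_image] at hx
    obtain ⟨s, hs, hsx⟩ := hx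
    have hs1 : s = 1 := by
      have h' : s * x = 1 * x := by rw [one_mul]; exact hsx
      exact mul_right_cancel h'
    exact h1 (hs1 ▸ hs)

/-- The ball of radius `n` in the word metric given by `S`. -/
def cball {Γ : Type*} [Group Γ] [DecidableEq Γ] (S : Finset Γ) : ℕ → Finset Γ
  | 0 => {1}
  | n + 1 => cball S n ∪ (cball S n).biUnion fun x => S.image fun s => s * x

/-- Amenability of a group, via the Følner condition. -/
def Amenable (Γ : Type*) [Group Γ] [DecidableEq Γ] : Prop :=
  ∀ (T : Finset Γ) (ε : ℝ), 0 < ε → ∃ F : Finset Γ, F.Nonempty ∧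
    ∀ t ∈ T, (((F.image fun x => t * x) \ F).card : ℝ) ≤ ε * (F.card : ℝ)

/-- The `ℓ^p`-norm of `f` is at most `M`. -/
def LpNormLe {ι : Type*} (p : ℝ) (f : ι → ℝ) (M : ℝ) : Prop :=
  ∀ F : Finset ι, (∑ i ∈ F, |f i| ^ p) ^ (1 / p) ≤ M

namespace LpNormLe

variable {ι κ : Type*} {p : ℝ} {f g : ι → ℝ} {M M' : ℝ}

lemma nonneg (hp : 0 < p) (hf : LpNormLe p f M) : 0 ≤ M := by
  simpa [Real.zero_rpow (inv_pos.2 hp).ne'] using hf ∅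

lemma mono (hf : LpNormLe p f M) (h : M ≤ M') : LpNormLe p f M' :=
  fun F => (hf F).trans h

lemma comp (hf : LpNormLe p f M) {φ : κ → ι} (hφ : Function.Injective φ) :
    LpNormLe p (fun i => f (φ i)) M := by
  intro F
  simpa [Finset.sum_map] using hf (F.map ⟨φ, hφ⟩)

lemma add (hp : 1 ≤ p) (hf : LpNormLe p f M) (hg : LpNormLe p g M') :
    LpNormLe p (fun i => f i + g i) (M + M') :=
  fun F => (Real.Lp_add_le F f g hp).trans (add_le_add (hf F) (hg F))

lemma neg (hf : LpNormLe p f M) : LpNormLe p (fun i => -f i) M := by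
  intro F
  simpa using hf F

lemma sub (hp : 1 ≤ p) (hf : LpNormLe p f M) (hg : LpNormLe p g M') :
    LpNormLe p (fun i => f i - g i) (M + M') := by
  simpa [sub_eq_add_neg] using hf.add hp hg.neg

lemma abs_le (hp : 0 < p) (hf : LpNormLe p f M) (i : ι) : |f i| ≤ M := by
  have h := hf {i}
  rwa [Finset.sum_singleton, one_div, Real.rpow_rpow_inv (abs_nonneg _) hp.ne'] at h

/-- Hölder's inequality for averages over finite sets. -/
lemma abs_expect_le (hp : 1 ≤ p) (hf : LpNormLe p f M) (B : Finset ι) (hB : B.Nonempty) :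
    |𝔼 i ∈ B, f i| ≤ (B.card : ℝ) ^ (-(1 / p)) * M := by
  have hp0 : 0 < p := one_pos.trans_le hp
  have hcard : (0 : ℝ) < B.card := by exact_mod_cast hB.card_pos
  have hM := hf.nonneg hp0
  have hsum : ∑ i ∈ B, |f i| ≤ (B.card : ℝ) ^ (1 - 1 / p) * M := by
    have hnn : 0 ≤ ∑ i ∈ B, |f i| := Finset.sum_nonneg fun _ _ => abs_nonneg _
    have h := Real.rpow_le_rpow (Real.rpow_nonneg hnn p)
      (Real.rpow_sum_le_const_mul_sum_rpow B f hp) (one_div_nonneg.2 hp0.le)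
    rw [one_div, Real.rpow_rpow_inv hnn hp0.ne', Real.mul_rpow (by positivity) (by positivity),
      ← Real.rpow_mul hcard.le] at h
    refine h.trans ?_
    rw [show (p - 1) * p⁻¹ = 1 - 1 / p by field_simp]
    gcongr
    simpa using hf B
  refine (Finset.abs_expect_le _ _).trans ?_
  rw [Finset.expect_eq_sum_div_card, div_le_iff₀ hcard]
  refine hsum.trans_eq ?_
  rw [sub_eq_add_neg, Real.rpow_add hcard, Real.rpow_one]
  ring

end LpNormLe

lemma lpMem.exists_lpNormLe {ι : Type*} {p : ℝ} {f : ι → ℝ} (hp : 0 < p) (hf : lpMem p f) :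
    LpNormLe p f ((∑' i, |f i| ^ p) ^ (1 / p)) := fun F =>
  Real.rpow_le_rpow (by positivity) (hf.sum_le_tsum F fun _ _ => by positivity) (by positivity)

section Energy

variable {H : Type*} [Group H] {S : Finset H} {p e e' M : ℝ} {f g : H → ℝ}

/-- All the increments of `f` along elements of `S` have `ℓ^p`-norm at most `e`. -/
def EnergyLe (S : Finset H) (p : ℝ) (f : H → ℝ) (e : ℝ) : Prop :=
  ∀ s ∈ S, LpNormLe p (fun x => f (s * x) - f x) e

lemma EnergyLe.sub (hp : 1 ≤ p) (hf : EnergyLe S p f e) (hg : EnergyLe S p g e') :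
    EnergyLe S p (fun x => f x - g x) (e + e') := by
  intro s hs
  convert (hf s hs).sub hp (hg s hs) using 2
  ring

variable [DecidableEq H]

lemma one_mem_cball (S : Finset H) (n : ℕ) : 1 ∈ cball S n := by
  induction n with
  | zero => simp [cball]
  | succ n ih => exact Finset.mem_union_left _ ih

lemma cball_nonempty (S : Finset H) (n : ℕ) : (cball S n).Nonempty := ⟨1, one_mem_cball S n⟩

lemma exists_mem_cball (hsym : ∀ s ∈ S, s⁻¹ ∈ S) (hgen : Subgroup.closure (S : Set H) = ⊤)
    (h : H) : ∃ n, h ∈ cball S n := by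
  have hh : h ∈ Subgroup.closure (S : Set H) := hgen ▸ Subgroup.mem_top h
  have key : ∀ s ∈ S, ∀ x n, x ∈ cball S n → s * x ∈ cball S (n + 1) := by
    intro s hs x n hx
    exact Finset.mem_union_right _
      (Finset.mem_biUnion.2 ⟨x, hx, Finset.mem_image_of_mem _ hs⟩)
  induction hh using Subgroup.closure_induction_left with
  | one => exact ⟨0, one_mem_cball S 0⟩
  | mul_left x hx y _ ih =>
    obtain ⟨n, hn⟩ := ih
    exact ⟨n + 1, key x hx y n hn⟩
  | inv_mul_cancel x hx y _ ih =>
    obtain ⟨n, hn⟩ := ih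
    exact ⟨n + 1, key _ (hsym x hx) y n hn⟩

lemma EnergyLe.of_mem_cball (hp : 1 ≤ p) (he : 0 ≤ e) (hf : EnergyLe S p f e) (n : ℕ) {h : H}
    (hh : h ∈ cball S n) : LpNormLe p (fun x => f (h * x) - f x) (n * e) := by
  have hp0 : 0 < p := one_pos.trans_le hp
  induction n generalizing h with
  | zero =>
    obtain rfl : h = 1 := by simpa [cball] using hh
    intro F
    simp [Real.zero_rpow hp0.ne', Real.zero_rpow (inv_pos.2 hp0).ne']
  | succ n ih =>
    rcases Finset.mem_union.1 hh with hh | hh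
    · refine (ih hh).mono ?_
      push_cast
      linarith
    · obtain ⟨x, hx, hh⟩ := Finset.mem_biUnion.1 hh
      obtain ⟨s, hs, rfl⟩ := Finset.mem_image.1 hh
      have h1 := ((hf s hs).comp (mul_right_injective x)).add hp (ih hx)
      convert h1 using 2
      · rw [mul_assoc]; ring
      · push_cast; ring

/-- The average of `f` over the ball of radius `n` translated to `x`. -/
noncomputable def ballAvg (S : Finset H) (n : ℕ) (f : H → ℝ) (x : H) : ℝ :=
  𝔼 h ∈ cball S n, f (h * x)

lemma abs_ballAvg_le_of_forall (n : ℕ) (hf : ∀ x, |f x| ≤ M) (x : H) : |ballAvg S n f x| ≤ M :=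
  (Finset.abs_expect_le _ _).trans
    (Finset.expect_le (cball_nonempty S n) fun _ _ => hf _)

lemma abs_ballAvg_le (hp : 1 ≤ p) (hf : LpNormLe p f M) (n : ℕ) (x : H) :
    |ballAvg S n f x| ≤ ((cball S n).card : ℝ) ^ (-(1 / p)) * M :=
  (hf.comp (mul_left_injective x)).abs_expect_le hp _ (cball_nonempty S n)

lemma abs_ballAvg_sub_ballAvg_ballAvg_le (hp : 1 ≤ p) (he : 0 ≤ e) (hf : EnergyLe S p f e)
    (n m : ℕ) (x : H) :
    |ballAvg S n f x - ballAvg S n (ballAvg S m f) x|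
      ≤ ((cball S n).card : ℝ) ^ (-(1 / p)) * (m * e) := by
  have h1 : ballAvg S n (ballAvg S m f) x - ballAvg S n f x =
      𝔼 k ∈ cball S m, 𝔼 h ∈ cball S n, (f (k * (h * x)) - f (h * x)) := by
    rw [Finset.expect_comm]
    simp only [ballAvg, Finset.expect_sub_distrib, Finset.expect_const (cball_nonempty S m)]
  rw [abs_sub_comm, h1]
  refine (Finset.abs_expect_le _ _).trans (Finset.expect_le (cball_nonempty S m) fun k hk => ?_)
  exact ((hf.of_mem_cball hp he m hk).comp (mul_left_injective x)).abs_expect_le hp _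
    (cball_nonempty S n)

/-- A Sobolev inequality: on a group with large enough growth, the sup norm of an `ℓ^p`-function
is controlled by its energy. -/
lemma abs_le_of_energyLe (hp : 1 ≤ p) (he : 0 ≤ e) {κ q : ℝ} (hκ : 0 ≤ κ) (hq0 : 0 ≤ q)
    (hq : 2 * q < 1)
    (hgrowth : ∀ j : ℕ, ((cball S (2 ^ j)).card : ℝ) ^ (-(1 / p)) ≤ κ * q ^ j)
    (hf : EnergyLe S p f e) (hfM : LpNormLe p f M) (x : H) :
    |f x| ≤ (1 + 2 * κ / (1 - 2 * q)) * e := by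
  have hM : 0 ≤ M := hfM.nonneg (one_pos.trans_le hp)
  have hr : 0 < 1 - 2 * q := by linarith
  have step : ∀ K j : ℕ, ∀ x, |ballAvg S (2 ^ j) f x|
      ≤ 2 * κ / (1 - 2 * q) * (2 * q) ^ j * e + κ * q ^ (j + K) * M := by
    intro K
    induction K with
    | zero =>
      intro j x
      have h1 := abs_ballAvg_le (S := S) hp hfM (2 ^ j) x
      have h2 := mul_le_mul_of_nonneg_right (hgrowth j) hM
      have h3 : 0 ≤ 2 * κ / (1 - 2 * q) * (2 * q) ^ j * e := by positivity
      simp only [add_zero]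
      linarith
    | succ K ih =>
      intro j x
      have h1 := abs_ballAvg_sub_ballAvg_ballAvg_le hp he hf (2 ^ j) (2 ^ (j + 1)) x
      have h2 := abs_ballAvg_le_of_forall (S := S) (2 ^ j) (ih (j + 1)) x
      have h3 := mul_le_mul_of_nonneg_right (hgrowth j)
        (show 0 ≤ ((2 ^ (j + 1) : ℕ) : ℝ) * e by positivity)
      have h4 : 2 * κ / (1 - 2 * q) * (2 * q) ^ j * e =
          κ * q ^ j * (((2 ^ (j + 1) : ℕ) : ℝ) * e)
            + 2 * κ / (1 - 2 * q) * (2 * q) ^ (j + 1) * e := by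
        push_cast
        field_simp
        ring
      have h5 := abs_sub_abs_le_abs_sub (ballAvg S (2 ^ j) f x)
        (ballAvg S (2 ^ j) (ballAvg S (2 ^ (j + 1)) f) x)
      rw [show j + 1 + K = j + (K + 1) by ring] at h2
      linarith
  have hlim : Tendsto (fun K : ℕ => 2 * κ / (1 - 2 * q) * e + κ * q ^ K * M) atTop
      (𝓝 (2 * κ / (1 - 2 * q) * e + κ * 0 * M)) :=
    (((tendsto_pow_atTop_nhds_zero_of_lt_one hq0 (by linarith)).const_mul κ).mul_const M).const_add _
  have h1 : ∀ x, |ballAvg S 1 f x| ≤ 2 * κ / (1 - 2 * q) * e := by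
    intro x
    have := ge_of_tendsto' hlim fun K => by simpa using step K 0 x
    simpa using this
  have h0 := abs_ballAvg_sub_ballAvg_ballAvg_le hp he hf 0 1 x
  have h2 := abs_ballAvg_le_of_forall (S := S) 0 h1 x
  have h3 : ballAvg S 0 f x = f x := by simp [ballAvg, cball]
  have h5 := abs_sub_abs_le_abs_sub (ballAvg S 0 f x) (ballAvg S 0 (ballAvg S 1 f) x)
  have h6 : ((cball S 0).card : ℝ) ^ (-(1 / p)) = 1 := by simp [cball]
  rw [h6] at h0
  rw [h3] at h5 h0
  push_cast at h0
  linarith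

end Energy

lemma LpNormLe.summable {ι : Type*} {p M : ℝ} {f : ι → ℝ} (hp : 0 < p) (hf : LpNormLe p f M) :
    Summable fun i => |f i| ^ p := by
  refine summable_of_sum_le (c := M ^ p) (fun _ => by positivity) fun F => ?_
  have hF : 0 ≤ ∑ i ∈ F, |f i| ^ p := by positivity
  have h := Real.rpow_le_rpow (by positivity) (hf F) hp.le
  rwa [one_div, Real.rpow_inv_rpow hF hp.ne'] at h

namespace LFGraph

variable {X : Type*} {G : LFGraph X} {p : ℝ} {g : X → ℝ}

lemma gradNorm_nonneg (G : LFGraph X) (p : ℝ) (g : X → ℝ) : 0 ≤ G.gradNorm p g :=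
  Real.rpow_nonneg (tsum_nonneg fun _ => by positivity) _

/-- A function in `D^p` which converges to a constant at infinity is in the closure of
`ℓ^p(X) + ℝ·1`, as shown by truncating it near this constant. -/
lemma MemDp.inClos_of_finite (hp : 1 ≤ p) (hg : G.MemDp p g) {c : ℝ}
    (hc : ∀ t, 0 < t → {x | t < |g x - c|}.Finite) (e0 : X) : G.InClos p e0 g := by
  have hp0 : 0 < p := one_pos.trans_le hp
  intro ε hε
  let u : ℝ → X → ℝ := fun t x => max (-t) (min t (g x - c))
  have hu1 : ∀ t x y, |u t y - u t x| ≤ |g y - g x| := by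
    intro t x y
    refine (abs_max_sub_max_le_max _ _ _ _).trans (max_le (by simp) ?_)
    refine (abs_min_sub_min_le_max _ _ _ _).trans (max_le (by simp) ?_)
    simp
  have hu2 : ∀ t, 0 < t → ∀ x, |u t x| ≤ t := by
    intro t ht x
    exact abs_le.2 ⟨le_max_left _ _, max_le (by linarith) (min_le_left _ _)⟩
  have hgrad : ∀ t (e : G.Edge), |G.grad (u t) e| ^ p ≤ |G.grad g e| ^ p := fun t e =>
    Real.rpow_le_rpow (abs_nonneg _) (hu1 t _ _) hp0.le
  have hmem : ∀ t, G.MemDp p (u t) := fun t =>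
    Summable.of_nonneg_of_le (fun _ => by positivity) (hgrad t) hg
  have hlim : Tendsto (fun t => G.gradNorm p (u t)) (𝓝[>] 0) (𝓝 0) := by
    have h1 : Tendsto (fun t => ∑' e : G.Edge, |G.grad (u t) e| ^ p) (𝓝[>] 0)
        (𝓝 (∑' _ : G.Edge, (0 : ℝ))) := by
      refine tendsto_tsum_of_dominated_convergence (bound := fun e => |G.grad g e| ^ p) hg
        (fun e => ?_) (Eventually.of_forall fun t e => ?_)
      · have h2 : Tendsto (fun t : ℝ => (2 * t) ^ p) (𝓝[>] 0) (𝓝 0) := by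
          have : ContinuousAt (fun t : ℝ => (2 * t) ^ p) 0 :=
            (continuousAt_const.mul continuousAt_id).rpow_const (Or.inr hp0.le)
          have := this.tendsto
          simp only [mul_zero, Real.zero_rpow hp0.ne'] at this
          exact this.mono_left nhdsWithin_le_nhds
        refine squeeze_zero' (Eventually.of_forall fun t => by positivity) ?_ h2
        filter_upwards [self_mem_nhdsWithin] with t ht
        refine Real.rpow_le_rpow (abs_nonneg _) ?_ hp0.le
        have h3 := hu2 t ht e.1.1
        have h4 := hu2 t ht e.1.2
        have h5 := abs_sub (u t e.1.2) (u t e.1.1)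
        simp only [grad]
        linarith
      · rw [Real.norm_of_nonneg (by positivity)]
        exact hgrad t e
    have h2 := h1.rpow_const (p := 1 / p) (Or.inr (by positivity))
    rwa [tsum_zero, Real.zero_rpow (by positivity)] at h2
  have hpos : ∀ᶠ t in 𝓝[>] (0 : ℝ), 0 < t := self_mem_nhdsWithin
  have hsmall : ∀ᶠ t in 𝓝[>] (0 : ℝ), t < ε / 2 :=
    nhdsWithin_le_nhds (eventually_lt_nhds (by positivity))
  obtain ⟨t, h1, ht, h2⟩ := ((hlim.eventually_lt_const (half_pos hε)).and
    (hpos.and hsmall)).exists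
  have hsub : ∀ x, g x - ((g x - c - u t x) + c) = u t x := fun x => by ring
  refine ⟨fun x => g x - c - u t x, c, ?_, ?_, ?_⟩
  · refine summable_of_hasFiniteSupport ((hc t ht).subset fun x hx => ?_)
    by_contra hx'
    rw [Set.mem_ofPred_eq, not_lt, abs_le] at hx'
    refine hx ?_
    simp [u, min_eq_right hx'.2, max_eq_right hx'.1, Real.zero_rpow hp0.ne']
  · simpa only [hsub] using hmem t
  · simp only [dpDist, hsub]
    linarith [hu2 t ht e0]

end LFGraph

section Cayley

variable {H : Type*} [Group H] [DecidableEq H] {S : Finset H} {hsym : ∀ s ∈ S, s⁻¹ ∈ S}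
  {h1 : (1 : H) ∉ S} {p e κ q : ℝ} {f : H → ℝ}

lemma LFGraph.MemDp.energyLe (hp : 0 < p) (hf : (cayley S hsym h1).MemDp p f) :
    EnergyLe S p f ((cayley S hsym h1).gradNorm p f) := by
  intro s hs
  let φ : H → (cayley S hsym h1).Edge := fun x => ⟨(x, s * x), Finset.mem_image_of_mem _ hs⟩
  have hφ : Function.Injective φ := fun x y hxy => congrArg (fun z => z.1.1) hxy
  have h := (lpMem.exists_lpNormLe hp hf).comp hφ
  simpa only [LFGraph.grad, LFGraph.gradNorm, φ] using h

lemma memDp_cayley_of_summable (h : ∀ s ∈ S, Summable fun x => |f (s * x) - f x| ^ p) :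
    (cayley S hsym h1).MemDp p f := by
  have hsum : Summable fun z : S × H => |f (z.1 * z.2) - f z.2| ^ p :=
    (summable_prod_of_nonneg fun _ => by positivity).2
      ⟨fun s => h s s.2, (hasSum_fintype _).summable⟩
  have hmem : ∀ z : (cayley S hsym h1).Edge, z.1.2 * z.1.1⁻¹ ∈ S := by
    rintro ⟨⟨x, y⟩, hy⟩
    obtain ⟨s, hs, hsx⟩ := Finset.mem_image.1 hy
    rw [← hsx]
    simpa using hs
  have hinj : Function.Injective (fun z : (cayley S hsym h1).Edge =>
      ((⟨z.1.2 * z.1.1⁻¹, hmem z⟩, z.1.1) : S × H)) := by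
    rintro ⟨⟨x, y⟩, hy⟩ ⟨⟨x', y'⟩, hy'⟩ hxy
    simp only [Prod.mk.injEq, Subtype.mk.injEq] at hxy
    obtain ⟨hxy, rfl⟩ := hxy
    obtain rfl := mul_right_cancel hxy
    rfl
  refine (hsum.comp_injective hinj).congr fun z => ?_
  simp [LFGraph.grad]

/-- On a group with large enough growth, the oscillation of a function in the closure of
`ℓ^p + ℝ·1` is controlled by its energy. -/
lemma LFGraph.InClos.abs_sub_le (hgen : Subgroup.closure (S : Set H) = ⊤) (hp : 1 ≤ p)
    (he : 0 ≤ e) (hκ : 0 ≤ κ) (hq0 : 0 ≤ q) (hq : 2 * q < 1)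
    (hgrowth : ∀ j : ℕ, ((cball S (2 ^ j)).card : ℝ) ^ (-(1 / p)) ≤ κ * q ^ j)
    (hf : EnergyLe S p f e) (hclos : ∀ x, (cayley S hsym h1).InClos p x f) (x y : H) :
    |f x - f y| ≤ 2 * (1 + 2 * κ / (1 - 2 * q)) * e := by
  have hp0 : 0 < p := one_pos.trans_le hp
  have hr : 0 < 1 - 2 * q := by linarith
  have hC : 0 < 1 + 2 * κ / (1 - 2 * q) := by positivity
  set C := 1 + 2 * κ / (1 - 2 * q)
  obtain ⟨n, hn⟩ := exists_mem_cball hsym hgen (y * x⁻¹)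
  refine le_of_forall_pos_le_add fun δ hδ => ?_
  have hD : 0 < 2 * C + n := by positivity
  obtain ⟨v, c, hv, hu, hdist⟩ := hclos x (δ / (2 * C + n)) (by positivity)
  set ε := δ / (2 * C + n)
  have hεδ : (2 * C + n) * ε = δ := mul_div_cancel₀ _ hD.ne'
  have hε : 0 < ε := by positivity
  have huE : EnergyLe S p (fun z => f z - (v z + c)) ε := fun s hs =>
    (hu.energyLe hp0 s hs).mono (by
      have := abs_nonneg (f x - (v x + c))
      simp only [dpDist] at hdist
      linarith)
  have hvE : EnergyLe S p v (e + ε) := by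
    intro s hs
    convert hf.sub hp huE s hs using 2
    ring
  have hvC := abs_le_of_energyLe hp (by positivity) hκ hq0 hq hgrowth hvE
    (lpMem.exists_lpNormLe hp0 hv)
  have hxy := (huE.of_mem_cball hp hε.le n hn).abs_le hp0 x
  rw [inv_mul_cancel_right] at hxy
  have hx := abs_le.1 (hvC x)
  have hy := abs_le.1 (hvC y)
  have hxy := abs_le.1 hxy
  rw [← hεδ]
  refine abs_le.2 ⟨?_, ?_⟩ <;> linarith

/-- On a group with large enough growth, the functions in the closure of
`ℓ^p + ℝ·1` have a limit at infinity. -/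
lemma exists_tendsto_cofinite [Infinite H] (hgen : Subgroup.closure (S : Set H) = ⊤) (hp : 1 ≤ p)
    (hκ : 0 ≤ κ) (hq0 : 0 ≤ q) (hq : 2 * q < 1)
    (hgrowth : ∀ j : ℕ, ((cball S (2 ^ j)).card : ℝ) ^ (-(1 / p)) ≤ κ * q ^ j)
    (htriv : ∀ (x : H) (g : H → ℝ), (cayley S hsym h1).MemDp p g →
      (cayley S hsym h1).InClos p x g)
    (hf : (cayley S hsym h1).MemDp p f) : ∃ c, Tendsto f cofinite (𝓝 c) := by
  have hp0 : 0 < p := one_pos.trans_le hp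
  have hr : 0 < 1 - 2 * q := by linarith
  have hC : 0 < 1 + 2 * κ / (1 - 2 * q) := by positivity
  refine CompleteSpace.complete (Metric.cauchy_iff.2 ⟨inferInstance, fun ε hε => ?_⟩)
  have hosc := fun (g : H → ℝ) (e : ℝ) (he : 0 ≤ e) (hg : (cayley S hsym h1).MemDp p g)
    (hgE : EnergyLe S p g e) => LFGraph.InClos.abs_sub_le (f := g) hgen hp he hκ hq0 hq hgrowth hgE
      (fun x => htriv x g hg)
  set C := 1 + 2 * κ / (1 - 2 * q)
  obtain ⟨v, c, hv, hu, hdist⟩ := htriv 1 f hf (ε / (2 * C + 3)) (by positivity)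
  set δ := ε / (2 * C + 3)
  have hδ : 0 < δ := by positivity
  have hδε : (2 * C + 3) * δ = ε := mul_div_cancel₀ _ (by positivity)
  have huE : EnergyLe S p (fun z => f z - (v z + c)) δ := fun s hs =>
    (hu.energyLe hp0 s hs).mono (by
      have := abs_nonneg (f 1 - (v 1 + c))
      simp only [LFGraph.dpDist] at hdist
      linarith)
  have hsmall : ∀ᶠ x in cofinite, |v x| < δ := by
    filter_upwards [hv.tendsto_cofinite_zero.eventually_lt_const (Real.rpow_pos_of_pos hδ p)]
      with x hx
    exact lt_of_not_ge fun hle => hx.not_ge (Real.rpow_le_rpow hδ.le hle hp0.le)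
  refine ⟨f '' {x | |v x| < δ}, image_mem_map hsmall, ?_⟩
  rintro _ ⟨x, hx, rfl⟩ _ ⟨y, hy, rfl⟩
  have h2 := abs_le.1 (hosc _ δ hδ.le hu huE x y)
  rw [Set.mem_ofPred_eq, abs_lt] at hx hy
  rw [Real.dist_eq, ← hδε]
  refine abs_lt.2 ⟨?_, ?_⟩ <;> linarith

end Cayley

lemma exists_card_cball_rpow_le {H : Type*} [Group H] [DecidableEq H] {S : Finset H} {p d c : ℝ}
    (hp : 0 < p) (hdp : p < d) (hc : 0 < c)
    (hgrowth : ∀ n : ℕ, 1 ≤ n → c * (n : ℝ) ^ d ≤ ((cball S n).card : ℝ)) :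
    ∃ κ q : ℝ, 0 ≤ κ ∧ 0 ≤ q ∧ 2 * q < 1 ∧
      ∀ j : ℕ, ((cball S (2 ^ j)).card : ℝ) ^ (-(1 / p)) ≤ κ * q ^ j := by
  refine ⟨c ^ (-(1 / p)), 2 ^ (-(d / p)), by positivity, by positivity, ?_, fun j => ?_⟩
  · calc (2 : ℝ) * 2 ^ (-(d / p)) = 2 ^ (1 - d / p) := by
          rw [sub_eq_add_neg, Real.rpow_add two_pos, Real.rpow_one]
      _ < 1 := Real.rpow_lt_one_of_one_lt_of_neg one_lt_two
          (sub_neg.2 ((one_lt_div hp).2 hdp))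
  · have h := hgrowth (2 ^ j) Nat.one_le_two_pow
    push_cast at h
    refine (Real.rpow_le_rpow_of_nonpos (by positivity) h
      (neg_nonpos.2 (one_div_nonneg.2 hp.le))).trans_eq ?_
    rw [Real.mul_rpow hc.le (by positivity), ← Real.rpow_mul (by positivity),
      ← Real.rpow_natCast, ← Real.rpow_natCast, ← Real.rpow_mul two_pos.le,
      ← Real.rpow_mul two_pos.le]
    congr 2
    ring

/-- Let `1 ≤ p < ∞`, `G` finitely generated, `N ⊲ G` infinite,
finitely generated, of growth at least polynomial of degree `d > 2p`, with `G/N`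
infinite and the reduced `ℓ^p`-cohomology in degree one of a Cayley graph of `N`
trivial. Then every Cayley graph of `G` has trivial reduced `ℓ^p`-cohomology in
degree one. -/
theorem stmt8 {Γ : Type*} [Group Γ] [DecidableEq Γ]
    (p : ℝ) (hp : 1 ≤ p)
    (N : Subgroup Γ) [N.Normal] [Infinite N] [Infinite (Γ ⧸ N)]
    (S : Finset N) (hSsym : ∀ s ∈ S, s⁻¹ ∈ S) (hS1 : (1 : N) ∉ S)
    (hSgen : Subgroup.closure (S : Set N) = ⊤)
    (d c : ℝ) (hdp : 2 * p < d) (hc : 0 < c)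
    (hgrowth : ∀ n : ℕ, 1 ≤ n → c * (n : ℝ) ^ d ≤ ((cball S n).card : ℝ))
    (hNtriv : ∀ (e0 : N) (g : N → ℝ), (cayley S hSsym hS1).MemDp p g →
      (cayley S hSsym hS1).InClos p e0 g)
    (T : Finset Γ) (hTsym : ∀ t ∈ T, t⁻¹ ∈ T) (hT1 : (1 : Γ) ∉ T)
    (hTgen : Subgroup.closure (T : Set Γ) = ⊤)
    (e0 : Γ) (g : Γ → ℝ) (hg : (cayley T hTsym hT1).MemDp p g) :
    (cayley T hTsym hT1).InClos p e0 g := by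
  have hp0 : 0 < p := one_pos.trans_le hp
  obtain ⟨κ, q, hκ, hq0, hq, hball⟩ :=
    exists_card_cball_rpow_le hp0 (by linarith) hc hgrowth
  have hr : 0 < 1 - 2 * q := by linarith
  have hC : 0 < 2 * (1 + 2 * κ / (1 - 2 * q)) := by positivity
  have hinc : ∀ h : Γ, Summable fun x => |g (h * x) - g x| ^ p := by
    intro h
    obtain ⟨n, hn⟩ := exists_mem_cball hTsym hTgen h
    exact ((hg.energyLe hp0).of_mem_cball hp
      (LFGraph.gradNorm_nonneg _ _ _) n hn).summable hp0
  have hinj : ∀ x : Γ, Function.Injective fun n : N => (n : Γ) * x := fun x =>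
    (mul_left_injective x).comp Subtype.val_injective
  have hmem : ∀ x : Γ, (cayley S hSsym hS1).MemDp p fun n : N => g (n * x) := by
    intro x
    refine memDp_cayley_of_summable fun s _ => ?_
    refine ((hinc s).comp_injective (hinj x)).congr fun n => ?_
    simp [mul_assoc]
  obtain ⟨a, ha⟩ := exists_tendsto_cofinite hSgen hp hκ hq0 hq hball hNtriv (hmem 1)
  have hlim : ∀ x : Γ, Tendsto (fun n : N => g (n * x)) cofinite (𝓝 a) := by
    intro x
    have hdiff : Tendsto (fun n : N => g (x * n) - g n) cofinite (𝓝 0) := by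
      have h := ((hinc x).comp_injective Subtype.val_injective :
        Summable fun n : N => |g (x * n) - g n| ^ p).tendsto_cofinite_zero
      have h := h.rpow_const (p := 1 / p) (Or.inr (by positivity))
      rw [Real.zero_rpow (by positivity)] at h
      refine (tendsto_zero_iff_abs_tendsto_zero _).2 (h.congr fun n => ?_)
      rw [one_div]
      exact Real.rpow_rpow_inv (abs_nonneg _) hp0.ne'
    have hx : Tendsto (fun n : N => g (x * n)) cofinite (𝓝 a) := by
      simpa using hdiff.add ha
    let φ : N → N := fun n => ⟨x⁻¹ * n * x, by
      simpa using (inferInstance : N.Normal).conj_mem n n.2 x⁻¹⟩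
    have hφ : Function.Injective φ := fun m n hmn => by
      simpa [φ] using hmn
    refine (hx.comp hφ.tendsto_cofinite).congr fun n => ?_
    simp [φ, mul_assoc]
  have hosc : ∀ (x : Γ) (e : ℝ), 0 ≤ e → EnergyLe S p (fun n : N => g (n * x)) e →
      |g x - a| ≤ 2 * (1 + 2 * κ / (1 - 2 * q)) * e := by
    intro x e he hE
    refine le_of_tendsto' ((hlim x).const_sub (g x)).abs fun n => ?_
    simpa using LFGraph.InClos.abs_sub_le hSgen hp he hκ hq0 hq hball hE
      (fun y => hNtriv y _ (hmem x)) 1 n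
  refine hg.inClos_of_finite hp (c := a) (fun t ht => ?_) e0
  set C := 2 * (1 + 2 * κ / (1 - 2 * q))
  have he : 0 < t / C := by positivity
  have hφ : Summable fun x => ∑ s ∈ S, |g (s * x) - g x| ^ p :=
    summable_sum fun s _ => hinc s
  obtain ⟨F, hF⟩ := summable_iff_vanishing_norm.1 hφ ((t / C) ^ p) (by positivity)
  refine (F.finite_toSet.biUnion fun y _ => (Filter.eventually_cofinite.1
    ((hlim y).eventually (Metric.ball_mem_nhds a ht))).image fun n : N => (n : Γ) * y).subset
      fun x hx => ?_
  by_contra hxF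
  have hdisj : ∀ n : N, (n : Γ) * x ∉ F := by
    intro n hn
    refine hxF (Set.mem_biUnion hn ⟨n⁻¹, ?_, by simp⟩)
    rw [Set.mem_ofPred_eq] at hx ⊢
    simpa [Real.dist_eq] using hx.le
  have hE : EnergyLe S p (fun n : N => g (n * x)) (t / C) := by
    intro s hs K
    have h := (Real.le_norm_self _).trans_lt (hF (K.map ⟨_, hinj x⟩) ?_)
    · rw [Finset.sum_map] at h
      rw [one_div, Real.rpow_inv_le_iff_of_pos (by positivity) he.le hp0]
      refine le_trans (Finset.sum_le_sum fun n _ => ?_) h.le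
      refine le_trans (le_of_eq ?_) (Finset.single_le_sum
        (f := fun s : N => |g (s * (n * x)) - g (n * x)| ^ p)
        (fun _ _ => by positivity) hs)
      simp [mul_assoc]
    · refine Finset.disjoint_left.2 fun y hy => ?_
      obtain ⟨n, -, rfl⟩ := Finset.mem_map.1 hy
      exact hdisj n
  have h := hosc x _ he.le hE
  rw [mul_div_cancel₀ _ hC.ne'] at h
  exact absurd hx h.not_gt
end

section
/- Let 1 ≤ p < ∞ and let g ∈ D^p(Γ) be a function whose class in the reduced ℓ^p-cohomology in degree one is non-trivial (g is not in the D^p-closure of ℓ^p(X) + ℝ·1). For t > 0 define the truncation g_t by g_t(x) = g(x) if |g(x)| < t and g_t(x) = t·g(x)/|g(x)| if |g(x)| ≥ t. Then there exists t_0 > 0 such that for every t > t_0, g_t ∈ D^p(Γ) and the class of g_t in the reduced ℓ^p-cohomology is non-trivial. In particular, the reduced ℓ^p-cohomology in degree one of Γ is trivial if and only if every bounded function in D^p(Γ) lies in the D^p-closure of ℓ^p(X) + ℝ·1. -/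
open scoped BigOperators ENNReal NNReal
open Filter Topology

/-- Radial truncation of a real number at level `t`. -/
noncomputable def truncate (t a : ℝ) : ℝ := if |a| < t then a else t * a / |a|

theorem truncate_of_abs_lt {t a : ℝ} (h : |a| < t) : truncate t a = a := if_pos h

theorem truncate_eq_max_min {t : ℝ} (ht : 0 < t) (a : ℝ) :
    truncate t a = max (-t) (min t a) := by
  unfold truncate
  split_ifs with h
  · rw [min_eq_right (abs_lt.1 h).2.le, max_eq_right (abs_lt.1 h).1.le]
  · rcases le_total 0 a with ha | ha
    · rw [abs_of_nonneg ha] at h ⊢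
      rw [min_eq_left (not_lt.1 h), max_eq_right (by linarith),
        mul_div_cancel_right₀ t (by linarith)]
    · rw [abs_of_nonpos ha] at h ⊢
      rw [min_eq_right (by linarith), max_eq_left (by linarith), div_neg,
        mul_div_cancel_right₀ t (by linarith)]

theorem abs_truncate_le {t : ℝ} (ht : 0 < t) (a : ℝ) : |truncate t a| ≤ t := by
  rw [truncate_eq_max_min ht, abs_le]
  exact ⟨le_max_left _ _, max_le (by linarith) (min_le_left _ _)⟩

theorem truncate_mono {t : ℝ} (ht : 0 < t) : Monotone (truncate t) := by
  intro a b hab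
  simp only [truncate_eq_max_min ht]
  gcongr

theorem monotone_sub_truncate {t : ℝ} (ht : 0 < t) : Monotone fun a => a - truncate t a := by
  intro a b hab
  simp only [truncate_eq_max_min ht]
  grind

theorem abs_truncate_sub_le {t : ℝ} (ht : 0 < t) (a b : ℝ) :
    |truncate t b - truncate t a| ≤ |b - a| := by
  wlog h : a ≤ b generalizing a b
  · rw [abs_sub_comm, abs_sub_comm b]
    exact this b a (le_of_not_ge h)
  have h₁ := truncate_mono ht h
  have h₂ := monotone_sub_truncate ht h
  dsimp only at h₂
  rw [abs_of_nonneg (by linarith), abs_of_nonneg (by linarith)]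
  linarith

theorem abs_sub_truncate_sub_le {t : ℝ} (ht : 0 < t) (a b : ℝ) :
    |(b - truncate t b) - (a - truncate t a)| ≤ |b - a| := by
  wlog h : a ≤ b generalizing a b
  · rw [abs_sub_comm, abs_sub_comm b]
    exact this b a (le_of_not_ge h)
  have h₁ := truncate_mono ht h
  have h₂ := monotone_sub_truncate ht h
  dsimp only at h₂
  rw [abs_of_nonneg (by linarith), abs_of_nonneg (by linarith)]
  linarith

theorem lpMem.of_abs_le {ι : Type*} {p : ℝ} (hp : 0 ≤ p) {u v : ι → ℝ} (hv : lpMem p v)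
    (h : ∀ i, |u i| ≤ |v i|) : lpMem p u :=
  Summable.of_nonneg_of_le (fun _ => by positivity)
    (fun i => Real.rpow_le_rpow (abs_nonneg _) (h i) hp) hv

theorem lpMem.add {ι : Type*} {p : ℝ} (hp : 1 ≤ p) {u v : ι → ℝ} (hu : lpMem p u)
    (hv : lpMem p v) : lpMem p fun i => u i + v i := by
  have h := Real.summable_Lp_add_of_nonneg hp (fun i => abs_nonneg (u i))
    (fun i => abs_nonneg (v i)) hu hv
  exact Summable.of_nonneg_of_le (fun _ => by positivity)
    (fun i => Real.rpow_le_rpow (abs_nonneg _) (abs_add_le _ _) (by linarith)) h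

theorem lpMem.tsum_add_rpow_le {ι : Type*} {p : ℝ} (hp : 1 ≤ p) {u v : ι → ℝ} (hu : lpMem p u)
    (hv : lpMem p v) :
    (∑' i, |u i + v i| ^ p) ^ (1 / p) ≤
      (∑' i, |u i| ^ p) ^ (1 / p) + (∑' i, |v i| ^ p) ^ (1 / p) := by
  obtain ⟨hs, hle⟩ := Real.Lp_add_le_tsum_of_nonneg hp (fun i => abs_nonneg (u i))
    (fun i => abs_nonneg (v i)) hu hv
  refine le_trans (Real.rpow_le_rpow (tsum_nonneg fun _ => by positivity) ?_ (by positivity)) hle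
  exact (hu.add hp hv).tsum_le_tsum
    (fun i => Real.rpow_le_rpow (abs_nonneg _) (abs_add_le _ _) (by linarith)) hs

namespace LFGraph

theorem grad_add {X : Type*} (G : LFGraph X) (u v : X → ℝ) (e : G.Edge) :
    G.grad (fun x => u x + v x) e = G.grad u e + G.grad v e := by
  simp only [grad]
  ring

theorem MemDp.add {X : Type*} {G : LFGraph X} {p : ℝ} (hp : 1 ≤ p) {u v : X → ℝ}
    (hu : G.MemDp p u) (hv : G.MemDp p v) : G.MemDp p fun x => u x + v x := by
  unfold MemDp
  rw [funext (G.grad_add u v)]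
  exact lpMem.add hp hu hv

theorem gradNorm_add_le {X : Type*} {G : LFGraph X} {p : ℝ} (hp : 1 ≤ p) {u v : X → ℝ}
    (hu : G.MemDp p u) (hv : G.MemDp p v) :
    G.gradNorm p (fun x => u x + v x) ≤ G.gradNorm p u + G.gradNorm p v := by
  unfold gradNorm
  simp only [grad_add]
  exact lpMem.tsum_add_rpow_le hp hu hv

theorem dpDist_triangle {X : Type*} {G : LFGraph X} {p : ℝ} (hp : 1 ≤ p) (e0 : X)
    {u v w : X → ℝ} (huv : G.MemDp p fun x => u x - v x) (hvw : G.MemDp p fun x => v x - w x) :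
    G.dpDist p e0 u w ≤ G.dpDist p e0 u v + G.dpDist p e0 v w := by
  have h := gradNorm_add_le hp huv hvw
  simp only [sub_add_sub_cancel] at h
  have := abs_sub_le (u e0) (v e0) (w e0)
  unfold dpDist
  linarith

/-- The set of functions with trivial reduced class is closed in `D^p`. -/
theorem InClos.of_forall_dpDist_lt {X : Type*} {G : LFGraph X} {p : ℝ} (hp : 1 ≤ p) {e0 : X}
    {g : X → ℝ} (h : ∀ ε : ℝ, 0 < ε → ∃ k : X → ℝ, G.InClos p e0 k ∧
      G.MemDp p (fun x => g x - k x) ∧ G.dpDist p e0 g k < ε) : G.InClos p e0 g := by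
  intro ε hε
  obtain ⟨k, hk, hgk, hd⟩ := h (ε / 2) (half_pos hε)
  obtain ⟨f, c, hf, hkf, hd'⟩ := hk (ε / 2) (half_pos hε)
  refine ⟨f, c, hf, ?_, ?_⟩
  · simpa only [sub_add_sub_cancel] using hgk.add hp hkf
  · linarith [dpDist_triangle hp e0 hgk hkf]

theorem MemDp.truncate {X : Type*} {G : LFGraph X} {p : ℝ} (hp : 0 ≤ p) {g : X → ℝ}
    (hg : G.MemDp p g) {t : ℝ} (ht : 0 < t) : G.MemDp p fun x => truncate t (g x) :=
  lpMem.of_abs_le hp hg fun _ => abs_truncate_sub_le ht _ _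

theorem MemDp.sub_truncate {X : Type*} {G : LFGraph X} {p : ℝ} (hp : 0 ≤ p) {g : X → ℝ}
    (hg : G.MemDp p g) {t : ℝ} (ht : 0 < t) :
    G.MemDp p fun x => g x - _root_.truncate t (g x) :=
  lpMem.of_abs_le hp hg fun _ => abs_sub_truncate_sub_le ht _ _

theorem tendsto_dpDist_truncate {X : Type*} {G : LFGraph X} {p : ℝ} (hp : 0 < p) (e0 : X)
    {g : X → ℝ} (hg : G.MemDp p g) :
    Tendsto (fun t => G.dpDist p e0 g fun x => truncate t (g x)) atTop (𝓝 0) := by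
  have hpt : ∀ a : ℝ, ∀ᶠ t in atTop, truncate t a = a := fun a =>
    (eventually_gt_atTop |a|).mono fun _ => truncate_of_abs_lt
  have hsum : Tendsto
      (fun t => ∑' e : G.Edge, |G.grad (fun x => g x - truncate t (g x)) e| ^ p) atTop
      (𝓝 (∑' _ : G.Edge, (0 : ℝ))) := by
    refine tendsto_tsum_of_dominated_convergence hg (fun e => ?_) ?_
    · refine tendsto_const_nhds.congr' ?_
      filter_upwards [hpt (g e.1.1), hpt (g e.1.2)] with t h₁ h₂
      simp [grad, h₁, h₂, Real.zero_rpow hp.ne']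
    · filter_upwards [eventually_gt_atTop 0] with t ht e
      rw [Real.norm_of_nonneg (by positivity)]
      exact Real.rpow_le_rpow (abs_nonneg _) (abs_sub_truncate_sub_le ht _ _) hp.le
  have hnorm := hsum.rpow_const (p := 1 / p) (Or.inr (by positivity))
  rw [tsum_zero, Real.zero_rpow (by positivity)] at hnorm
  have hbase : Tendsto (fun t => |g e0 - truncate t (g e0)|) atTop (𝓝 0) :=
    tendsto_const_nhds.congr' ((hpt (g e0)).mono fun t h => by simp [h])
  simpa only [add_zero, dpDist, gradNorm] using hnorm.add hbase

/-- Truncations of a function with non-trivial reduced class eventually have non-trivial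
reduced class. -/
theorem exists_forall_not_inClos_truncate {X : Type*} {G : LFGraph X} {p : ℝ} (hp : 1 ≤ p)
    {e0 : X} {g : X → ℝ} (hg : G.MemDp p g) (hnt : ¬ G.InClos p e0 g) :
    ∃ t0 : ℝ, 0 < t0 ∧ ∀ t : ℝ, t0 < t → ¬ G.InClos p e0 fun x => truncate t (g x) := by
  by_contra! h
  refine hnt (InClos.of_forall_dpDist_lt hp fun ε hε => ?_)
  obtain ⟨T, hT⟩ := eventually_atTop.1
    ((tendsto_dpDist_truncate (by linarith) e0 hg).eventually (gt_mem_nhds hε))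
  obtain ⟨t, ht, hclos⟩ := h (max T 1) (by positivity)
  have ht0 : 0 < t := by linarith [le_max_right T 1]
  exact ⟨_, hclos, hg.sub_truncate (by linarith) ht0, hT t (by linarith [le_max_left T 1])⟩

end LFGraph

/-- Holopainen–Soardi: if `g ∈ D^p(Γ)` has non-trivial reduced
class, then for all sufficiently large `t` the truncation `g_t` has non-trivial
reduced class; in particular the reduced `ℓ^p`-cohomology in degree one is
trivial iff every bounded function of `D^p(Γ)` has trivial class. -/
theorem stmt9 {X : Type*} (G : LFGraph X) (hconn : G.Conn) (D : ℕ) (hval : G.BddVal D)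
    (p : ℝ) (hp : 1 ≤ p) (e0 : X)
    (g : X → ℝ) (hg : G.MemDp p g) (hnt : ¬ G.InClos p e0 g) :
    (∃ t0 : ℝ, 0 < t0 ∧ ∀ t : ℝ, t0 < t →
      G.MemDp p (fun x => if |g x| < t then g x else t * g x / |g x|) ∧
      ¬ G.InClos p e0 (fun x => if |g x| < t then g x else t * g x / |g x|)) ∧
    ((∀ h : X → ℝ, G.MemDp p h → G.InClos p e0 h) ↔
      ∀ h : X → ℝ, G.MemDp p h → BoundedFun h → G.InClos p e0 h) := by
  refine ⟨?_, fun h k hk _ => h k hk, fun h k hk => ?_⟩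
  · obtain ⟨t0, ht0, hT⟩ := LFGraph.exists_forall_not_inClos_truncate hp hg hnt
    exact ⟨t0, ht0, fun t ht => ⟨hg.truncate (by linarith) (ht0.trans ht), hT t ht⟩⟩
  · by_contra hk'
    obtain ⟨t0, ht0, hT⟩ := LFGraph.exists_forall_not_inClos_truncate hp hk hk'
    have ht : 0 < t0 + 1 := by linarith
    exact hT (t0 + 1) (by linarith) (h _ (hk.truncate (by linarith) ht)
      ⟨t0 + 1, fun x => abs_truncate_le ht (k x)⟩)
end

section
/- Let 1 ≤ p < ∞ and let h ∈ D^p(Γ) be of minimal D^p-norm in its cohomology class, i.e. ‖∇h‖_{ℓ^p(E)} ≤ ‖∇(h+f)‖_{ℓ^p(E)} for every finitely supported (hence every ℓ^p) perturbation f keeping the class, in particular for every f ∈ ℓ^p(X). Suppose there exists a constant c ∈ ℝ such that for every ε > 0 the set {x ∈ X : |h(x) − c| ≥ ε} is finite. Then h is constant. -/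
open scoped BigOperators ENNReal NNReal
open Filter Topology

/-- Truncation to the interval `[-t, t]` is nonexpansive. -/
theorem abs_clamp_sub_clamp_le (t a b : ℝ) :
    |max (-t) (min t b) - max (-t) (min t a)| ≤ |b - a| :=
  (abs_max_sub_max_le_max _ _ _ _).trans <| by
    simpa using abs_min_sub_min_le_max t b t a

/-- Truncation to the interval `[-t, t]` takes values at mutual distance at most `2 * t`. -/
theorem abs_clamp_sub_clamp_le_two_mul {t : ℝ} (ht : 0 ≤ t) (a b : ℝ) :
    |max (-t) (min t b) - max (-t) (min t a)| ≤ 2 * t := by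
  have hmem (u : ℝ) : -t ≤ max (-t) (min t u) ∧ max (-t) (min t u) ≤ t :=
    ⟨le_max_left _ _, max_le (by linarith) (min_le_left _ _)⟩
  rw [abs_le]
  constructor <;> linarith [(hmem a).1, (hmem a).2, (hmem b).1, (hmem b).2]

/-- A finitely supported function is `p`-summable for `p ≠ 0`. -/
theorem lpMem_of_finite {ι : Type*} {p : ℝ} (hp : p ≠ 0) {f : ι → ℝ} {s : Set ι}
    (hs : s.Finite) (hf : ∀ i ∉ s, f i = 0) : lpMem p f :=
  summable_of_ne_finset_zero (s := hs.toFinset) fun i hi => by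
    rw [hf i (by simpa using hi), abs_zero, Real.zero_rpow hp]

/-- A function on a connected graph with vanishing gradient is constant. -/
theorem LFGraph.Conn.eq_of_grad_eq_zero {X : Type*} {G : LFGraph X} (hconn : G.Conn)
    {h : X → ℝ} (hgrad : ∀ e, G.grad h e = 0) (x y : X) : h x = h y := by
  induction hconn x y with
  | refl => rfl
  | tail _ hadj ih => exact ih.trans (sub_eq_zero.mp (hgrad ⟨(_, _), hadj⟩)).symm

/-- An element of `D^p(Γ)` of minimal `D^p`-norm in its cohomology
class which is essentially constant at infinity is constant. -/
theorem stmt10 {X : Type*} (G : LFGraph X) (hconn : G.Conn) (D : ℕ) (hval : G.BddVal D)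
    (p : ℝ) (hp : 1 ≤ p) (h : X → ℝ) (hmem : G.MemDp p h)
    (hmin : ∀ f : X → ℝ, lpMem p f →
      (∑' e : G.Edge, |G.grad h e| ^ p) ≤ ∑' e : G.Edge, |G.grad (fun x => h x + f x) e| ^ p)
    (c : ℝ) (hc : ∀ ε : ℝ, 0 < ε → {x : X | ε ≤ |h x - c|}.Finite) :
    ∀ x y, h x = h y := by
  have hp0 : 0 < p := by linarith
  refine hconn.eq_of_grad_eq_zero fun e => ?_
  by_contra hne
  have hpos : 0 < |G.grad h e| := abs_pos.mpr hne
  set t : ℝ := |G.grad h e| / 4 with ht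
  have ht0 : 0 < t := by positivity
  set f : X → ℝ := fun x => max (-t) (min t (h x - c)) - (h x - c) with hf
  have hfmem : lpMem p f := by
    refine lpMem_of_finite hp0.ne' (hc t ht0) fun x hx => ?_
    have hlt : |h x - c| < t := not_le.mp hx
    rw [abs_lt] at hlt
    simp only [hf]
    rw [min_eq_right hlt.2.le, max_eq_right hlt.1.le, sub_self]
  have hgrad (e' : G.Edge) : G.grad (fun x => h x + f x) e' =
      max (-t) (min t (h e'.1.2 - c)) - max (-t) (min t (h e'.1.1 - c)) := by
    simp only [LFGraph.grad, hf]
    ring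
  have hle (e' : G.Edge) :
      |G.grad (fun x => h x + f x) e'| ^ p ≤ |G.grad h e'| ^ p := by
    refine Real.rpow_le_rpow (abs_nonneg _) ?_ hp0.le
    rw [hgrad]
    simpa [LFGraph.grad] using abs_clamp_sub_clamp_le t (h e'.1.1 - c) (h e'.1.2 - c)
  have hlt : |G.grad (fun x => h x + f x) e| ^ p < |G.grad h e| ^ p := by
    refine Real.rpow_lt_rpow (abs_nonneg _) ?_ hp0
    rw [hgrad]
    exact (abs_clamp_sub_clamp_le_two_mul ht0.le _ _).trans_lt (by linarith)
  have hsum : Summable fun e' => |G.grad (fun x => h x + f x) e'| ^ p :=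
    Summable.of_nonneg_of_le (fun _ => by positivity) hle hmem
  exact (hmin f hfmem).not_gt (hsum.tsum_lt_tsum hle hlt hmem)
end

section
/- Let 1 ≤ p < ∞ with Hölder conjugate p', and let P^{(n)}_x denote the time-n distribution of the simple random walk on Γ started at x. If for every x ∈ X the series ∑_{i≥0} ‖P^{(i)}_x‖_{ℓ^{p'}(X)} converges, then for every g ∈ D^p(Γ) and every x ∈ X the limit lim_{n→∞} ∑_y P^{(n)}_x(y) g(y) exists; that is, every g ∈ D^p(Γ) admits a boundary value for the simple random walk. -/
open scoped BigOperators ENNReal NNReal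
open Filter Topology

/-- Hölder's inequality for finite sums, with the norms of `lpENorm`. -/
theorem sum_enorm_mul_le_lpENorm_mul_lpENorm {ι : Type*} (s : Finset ι) {p : ℝ} (hp : 1 ≤ p)
    {q : ℝ≥0∞} (hq : 1 / ENNReal.ofReal p + 1 / q = 1) (f h : ι → ℝ) :
    ∑ i ∈ s, ‖f i‖ₑ * ‖h i‖ₑ ≤ lpENorm q f * lpENorm (ENNReal.ofReal p) h := by
  have hp0 : 0 < p := by linarith
  unfold lpENorm
  rw [if_neg (ENNReal.ofReal_ne_top (r := p)), ENNReal.toReal_ofReal hp0.le]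
  split_ifs with hqt
  · have hp1 : p = 1 := by
      rw [hqt, ENNReal.div_top, add_zero, one_div, ENNReal.inv_eq_one, ENNReal.ofReal_eq_one] at hq
      exact hq
    subst hp1
    simp only [ENNReal.rpow_one, div_one]
    calc ∑ i ∈ s, ‖f i‖ₑ * ‖h i‖ₑ
        ≤ ∑ i ∈ s, (⨆ i, ‖f i‖ₑ) * ‖h i‖ₑ := by
          gcongr with i
          exact le_iSup (fun i => ‖f i‖ₑ) i
      _ = (⨆ i, ‖f i‖ₑ) * ∑ i ∈ s, ‖h i‖ₑ := by rw [Finset.mul_sum]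
      _ ≤ _ := by
          exact mul_le_mul_right (ENNReal.sum_le_tsum s) _
  · have hq0 : q ≠ 0 := by
      rintro rfl
      simp at hq
    have hqpos : 0 < q.toReal := ENNReal.toReal_pos hq0 hqt
    have hinv : p⁻¹ + q.toReal⁻¹ = 1 := by
      have h1 := congrArg ENNReal.toReal hq
      rw [ENNReal.toReal_add (by simp [hp0]) (by simp [hq0])] at h1
      simpa [ENNReal.toReal_ofReal hp0.le] using h1
    have hp1 : 1 < p := by
      have : p⁻¹ < 1 := by linarith [inv_pos.mpr hqpos]
      exact (inv_lt_one₀ hp0).mp this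
    have hpq : p.HolderConjugate q.toReal := Real.holderConjugate_iff.mpr ⟨hp1, hinv⟩
    refine (ENNReal.inner_le_Lp_mul_Lq s _ _ hpq.symm).trans ?_
    exact mul_le_mul'
      (ENNReal.rpow_le_rpow (ENNReal.sum_le_tsum s) (by positivity))
      (ENNReal.rpow_le_rpow (ENNReal.sum_le_tsum s) (by positivity))

/-- A `p`-summable function has finite `ℓ^p`-norm. -/
theorem lpMem.lpENorm_ne_top {ι : Type*} {p : ℝ} (hp : 0 < p) {f : ι → ℝ} (hf : lpMem p f) :
    lpENorm (ENNReal.ofReal p) f ≠ ⊤ := by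
  unfold lpENorm
  rw [if_neg (ENNReal.ofReal_ne_top (r := p)), ENNReal.toReal_ofReal hp.le]
  refine ENNReal.rpow_ne_top_of_nonneg (by positivity) ?_
  have hterm : ∀ i, (‖f i‖₊ : ℝ≥0∞) ^ p = ENNReal.ofReal (|f i| ^ p) := fun i => by
    rw [← ENNReal.ofReal_rpow_of_nonneg (abs_nonneg _) hp.le, ← Real.norm_eq_abs,
      ofReal_norm]
    rfl
  simp_rw [hterm]
  exact Summable.tsum_ofReal_ne_top hf

namespace LFGraph

variable {X : Type*}

theorem finite_support_walk (G : LFGraph X) (n : ℕ) (x : X) :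
    (Function.support (G.walk n x)).Finite := by
  induction n generalizing x with
  | zero =>
    refine (Set.finite_singleton x).subset fun y hy => ?_
    by_contra hne
    exact hy (if_neg hne)
  | succ n ih =>
    refine ((G.nbr x).finite_toSet.biUnion fun z _ => ih z).subset fun y hy => ?_
    by_contra hne
    refine hy ?_
    simp only [Set.mem_iUnion, Function.mem_support, not_exists, not_not] at hne
    simp only [walk]
    rw [Finset.sum_eq_zero fun z hz => hne z hz, zero_div]

theorem summable_walk_mul (G : LFGraph X) (n : ℕ) (f : X → ℝ) (x : X) :
    Summable fun y => G.walk n x y * f y :=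
  summable_of_hasFiniteSupport ((G.finite_support_walk n x).subset
    (Function.support_mul_subset_left _ _))

theorem avg_zero (G : LFGraph X) (f : X → ℝ) : G.avg 0 f = f := by
  funext x
  unfold avg
  rw [tsum_eq_single x fun y hy => by simp [walk, hy]]
  simp [walk]

theorem avg_succ (G : LFGraph X) (n : ℕ) (f : X → ℝ) : G.avg (n + 1) f = G.pAvg (G.avg n f) := by
  funext x
  simp only [avg, pAvg, walk]
  rw [← Summable.tsum_finsetSum fun z _ => G.summable_walk_mul n f z, ← tsum_div_const]
  refine tsum_congr fun y => ?_
  rw [div_mul_eq_mul_div, Finset.sum_mul]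

theorem avg_succ_eq_avg_pAvg (G : LFGraph X) (n : ℕ) (f : X → ℝ) :
    G.avg (n + 1) f = G.avg n (G.pAvg f) := by
  induction n with
  | zero => rw [avg_succ, avg_zero, avg_zero]
  | succ n ih => rw [avg_succ, ih, ← avg_succ]

theorem avg_succ_sub_avg (G : LFGraph X) (n : ℕ) (f : X → ℝ) (x : X) :
    G.avg (n + 1) f x - G.avg n f x = G.avg n (fun y => G.pAvg f y - f y) x := by
  rw [avg_succ_eq_avg_pAvg]
  unfold avg
  rw [← (G.summable_walk_mul n _ x).tsum_sub (G.summable_walk_mul n _ x)]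
  exact tsum_congr fun y => (mul_sub _ _ _).symm

theorem enorm_avg_le (G : LFGraph X) {p : ℝ} (hp : 1 ≤ p) {q : ℝ≥0∞}
    (hq : 1 / ENNReal.ofReal p + 1 / q = 1) (n : ℕ) (f : X → ℝ) (x : X) :
    ‖G.avg n f x‖ₑ ≤ lpENorm q (G.walk n x) * lpENorm (ENNReal.ofReal p) f := by
  have hsum : G.avg n f x = ∑ y ∈ (G.finite_support_walk n x).toFinset, G.walk n x y * f y :=
    tsum_eq_sum fun y hy => by
      rw [Set.Finite.mem_toFinset, Function.mem_support, not_not] at hy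
      rw [hy, zero_mul]
  rw [hsum]
  refine (enorm_sum_le _ _).trans ?_
  simp_rw [enorm_mul]
  exact sum_enorm_mul_le_lpENorm_mul_lpENorm _ hp hq _ _

/-- A connected graph with an isolated vertex is reduced to that vertex. -/
theorem Conn.subsingleton_of_nbr_eq_empty {G : LFGraph X} (hG : G.Conn) {x : X}
    (hx : G.nbr x = ∅) : Subsingleton X := by
  have heq : ∀ y, x = y := fun y => by
    rcases (hG x y).cases_head with h | ⟨z, hz, _⟩
    · exact h
    · simp [Adj, hx] at hz
  exact ⟨fun a b => (heq a).symm.trans (heq b)⟩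

theorem abs_pAvg_sub_rpow_le (G : LFGraph X) {p : ℝ} (hp : 1 ≤ p) (g : X → ℝ) {x : X}
    (hx : (G.nbr x).Nonempty) :
    |G.pAvg g x - g x| ^ p ≤ ∑ y ∈ G.nbr x, |g y - g x| ^ p := by
  set d : ℝ := ((G.nbr x).card : ℝ) with hd
  have hd1 : 1 ≤ d := by
    rw [hd]
    exact_mod_cast hx.card_pos
  have hd0 : 0 < d := by linarith
  have hmean : G.pAvg g x - g x = ∑ y ∈ G.nbr x, d⁻¹ * (g y - g x) := by
    rw [← Finset.mul_sum, Finset.sum_sub_distrib, Finset.sum_const, nsmul_eq_mul, ← hd, pAvg, ← hd]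
    field_simp
  have habs : |G.pAvg g x - g x| ≤ ∑ y ∈ G.nbr x, d⁻¹ * |g y - g x| := by
    rw [hmean]
    refine (Finset.abs_sum_le_sum_abs _ _).trans_eq (Finset.sum_congr rfl fun y _ => ?_)
    rw [abs_mul, abs_of_pos (inv_pos.mpr hd0)]
  calc |G.pAvg g x - g x| ^ p
      ≤ (∑ y ∈ G.nbr x, d⁻¹ * |g y - g x|) ^ p := by gcongr
    _ ≤ ∑ y ∈ G.nbr x, d⁻¹ * |g y - g x| ^ p :=
        Real.rpow_arith_mean_le_arith_mean_rpow _ _ _ (fun _ _ => (inv_pos.mpr hd0).le)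
          (by rw [Finset.sum_const, nsmul_eq_mul, ← hd, mul_inv_cancel₀ hd0.ne'])
          (fun _ _ => abs_nonneg _) hp
    _ ≤ ∑ y ∈ G.nbr x, |g y - g x| ^ p := by
        gcongr with y
        exact mul_le_of_le_one_left (by positivity) (inv_le_one_of_one_le₀ hd1)

/-- The Laplacian of a function of `D^p` belongs to `ℓ^p`. -/
theorem MemDp.lpMem_pAvg_sub {G : LFGraph X} (hG : G.Conn) {p : ℝ} (hp : 1 ≤ p) {g : X → ℝ}
    (hg : G.MemDp p g) : lpMem p fun x => G.pAvg g x - g x := by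
  by_cases hne : ∀ x, (G.nbr x).Nonempty
  · let e : (Σ x : X, {y // y ∈ G.nbr x}) ≃ G.Edge :=
      { toFun := fun a => ⟨(a.1, a.2.1), a.2.2⟩
        invFun := fun a => ⟨a.1.1, a.1.2, a.2⟩
        left_inv := fun _ => rfl
        right_inv := fun _ => rfl }
    have hsig : Summable fun a : Σ x : X, {y // y ∈ G.nbr x} => |g a.2.1 - g a.1| ^ p :=
      e.summable_iff.mpr hg
    refine Summable.of_nonneg_of_le (fun x => by positivity)
      (fun x => G.abs_pAvg_sub_rpow_le hp g (hne x)) ?_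
    refine hsig.sigma.congr fun x => ?_
    rw [tsum_fintype]
    exact Finset.sum_coe_sort (G.nbr x) fun y => |g y - g x| ^ p
  · push Not at hne
    obtain ⟨x, hx⟩ := hne
    have := hG.subsingleton_of_nbr_eq_empty hx
    exact summable_of_hasFiniteSupport (Set.toFinite _)

end LFGraph

/-- if `∑_{i ≥ 0} ‖P^{(i)}_x‖_{ℓ^{p'}(X)} < ∞` for every `x`, then
every `g ∈ D^p(Γ)` admits a boundary value for the simple random walk. -/
theorem stmt12 {X : Type*} (G : LFGraph X) (hconn : G.Conn) (D : ℕ) (hval : G.BddVal D)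
    (p : ℝ) (hp : 1 ≤ p) (q : ℝ≥0∞) (hq : 1 / ENNReal.ofReal p + 1 / q = 1)
    (hsum : ∀ x : X, ∑' i : ℕ, lpENorm q (G.walk i x) ≠ ⊤)
    (g : X → ℝ) (hg : G.MemDp p g) (x : X) :
    ∃ L : ℝ, Filter.Tendsto (fun n => G.avg n g x) Filter.atTop (nhds L) := by
  set h : X → ℝ := fun y => G.pAvg g y - g y
  have hh : lpENorm (ENNReal.ofReal p) h ≠ ⊤ :=
    (hg.lpMem_pAvg_sub hconn hp).lpENorm_ne_top (by linarith)
  have hle : ∀ n, edist (G.avg n g x) (G.avg (n + 1) g x) ≤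
      lpENorm q (G.walk n x) * lpENorm (ENNReal.ofReal p) h := fun n => by
    rw [edist_comm, edist_eq_enorm_sub, G.avg_succ_sub_avg]
    exact G.enorm_avg_le hp hq n h x
  refine cauchySeq_tendsto_of_complete (cauchySeq_of_edist_le_of_tsum_ne_top _ hle ?_)
  rw [ENNReal.tsum_mul_right]
  exact ENNReal.mul_ne_top (hsum x) hh
end
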